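/- Let W be a pointy potential on ℝ^d with constants λ ∈ ℝ and w_∞ ≥ 0. Let μ and μ' be probability measures on ℝ^d with finite second moments, let Z be a characteristic flow for the aggregation equation with potential W and initial measure μ, let Z' be a characteristic flow with initial measure μ', and let π be any coupling of μ and μ'. Then for all t ≥ 0, ∬_{ℝ^d×ℝ^d} |Z(t,x) − Z'(t,y)|² π(dx,dy) ≤ e^{2|λ|t} ∬_{ℝ^d×ℝ^d} |x − y|² π(dx,dy). Consequently, d_W(Z(t,·)_#μ, Z'(t,·)_#μ') ≤ e^{|λ|t} d_W(μ, μ') for all t ≥ 0. -/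

import Mathlib

open MeasureTheory Real Set
open scoped RealInnerProductSpace ENNReal

noncomputable section

/-- `ℝ^d` with the Euclidean structure. -/
abbrev Euc (d : ℕ) := EuclideanSpace ℝ (Fin d)

open Classical in
/-- `∇̂W`: the gradient of `W` away from `0`, and `0` at `0`. -/
def hatGrad {d : ℕ} (W : Euc d → ℝ) (x : Euc d) : Euc d :=
  if x = 0 then 0 else gradient W x

/-- `Z` is a characteristic flow for the aggregation equation with potential `W`
and initial measure `μ`. -/
def IsCharFlow {d : ℕ} (W : Euc d → ℝ) (μ : Measure (Euc d)) (Z : ℝ → Euc d → Euc d) : Prop :=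
  (∀ x, Z 0 x = x) ∧
  ∀ t : ℝ, 0 ≤ t → ∀ x,
    Z t x = x - ∫ s in (0:ℝ)..t, ∫ x', hatGrad W (Z s x - Z s x') ∂μ

/-- `γ` is a coupling of `μ` and `ν`. -/
def IsCoupling {d : ℕ} (γ : Measure (Euc d × Euc d)) (μ ν : Measure (Euc d)) : Prop :=
  IsProbabilityMeasure γ ∧ γ.map Prod.fst = μ ∧ γ.map Prod.snd = ν

/-- The quadratic Wasserstein distance. -/
def wDist {d : ℕ} (μ ν : Measure (Euc d)) : ℝ :=
  Real.sqrt (sInf {r : ℝ | ∃ γ : Measure (Euc d × Euc d),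
    IsCoupling γ μ ν ∧ r = ∫ p, ‖p.1 - p.2‖ ^ 2 ∂γ})

open Filter Topology

theorem measurable_hatGrad {d : ℕ} (W : Euc d → ℝ) : Measurable (hatGrad W) := by
  refine Measurable.ite (measurableSet_singleton 0) measurable_const ?_
  exact (InnerProductSpace.toDual ℝ (Euc d)).symm.continuous.measurable.comp
    (measurable_fderiv ℝ W)

theorem norm_hatGrad_le {d : ℕ} {W : Euc d → ℝ} {w : ℝ} (hw : 0 ≤ w)
    (hbound : ∀ x : Euc d, x ≠ 0 → ‖gradient W x‖ ≤ w) (x : Euc d) : ‖hatGrad W x‖ ≤ w := by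
  unfold hatGrad
  split_ifs with h
  · simpa using hw
  · exact hbound x h

theorem hatGrad_neg {d : ℕ} {W : Euc d → ℝ} (hsymm : ∀ x : Euc d, W (-x) = W x) (x : Euc d) :
    hatGrad W (-x) = -hatGrad W x := by
  unfold hatGrad
  by_cases h : x = 0
  · simp [h]
  · have hW : (fun y => W (-y)) = W := funext hsymm
    have h1 : fderiv ℝ W (-x) = -fderiv ℝ W x := by
      have h2 := fderiv_comp_smul (𝕜 := ℝ) (f := W) (x := x) (-1)
      simp only [neg_smul, one_smul, hW] at h2
      rw [h2, neg_neg]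
    simp [h, gradient, h1]

/-- First-order condition for a convex function at a point of differentiability. -/
theorem ConvexOn.add_fderiv_le {E : Type*} [NormedAddCommGroup E] [NormedSpace ℝ E] {f : E → ℝ}
    {f' : E →L[ℝ] ℝ} {x : E} (hf : ConvexOn ℝ Set.univ f) (hf' : HasFDerivAt f f' x) (y : E) :
    f x + f' (y - x) ≤ f y := by
  have hg : ConvexOn ℝ Set.univ (fun t : ℝ => f (AffineMap.lineMap x y t)) := by
    simpa using! hf.comp_affineMap (AffineMap.lineMap (k := ℝ) x y)
  have hd : HasDerivAt (fun t : ℝ => f (AffineMap.lineMap x y t)) (f' (y - x)) 0 := by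
    have h0 : HasFDerivAt f f' (AffineMap.lineMap x y (0 : ℝ)) := by simpa using hf'
    exact h0.comp_hasDerivAt 0 AffineMap.hasDerivAt_lineMap
  have h := hg.le_slope_of_hasDerivAt (Set.mem_univ 0) (Set.mem_univ 1) one_pos hd
  simp only [slope_def_field, AffineMap.lineMap_apply_one, AffineMap.lineMap_apply_zero] at h
  linarith

theorem hatGrad_subgradient {d : ℕ} {W : Euc d → ℝ} {lam : ℝ}
    (hsymm : ∀ x : Euc d, W (-x) = W x)
    (hconv : ConvexOn ℝ Set.univ (fun x : Euc d => W x - lam / 2 * ‖x‖ ^ 2))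
    (hC1 : ContDiffOn ℝ 1 W {(0 : Euc d)}ᶜ) (x y : Euc d) :
    W x - lam / 2 * ‖x‖ ^ 2 + ⟪hatGrad W x - lam • x, y - x⟫ ≤ W y - lam / 2 * ‖y‖ ^ 2 := by
  by_cases hx : x = 0
  · subst hx
    have h := hconv.2 (Set.mem_univ y) (Set.mem_univ (-y)) (by norm_num : (0 : ℝ) ≤ 1 / 2)
      (by norm_num : (0 : ℝ) ≤ 1 / 2) (by norm_num)
    simp only [smul_neg, add_neg_cancel, hsymm, norm_neg, smul_eq_mul] at h
    simp only [hatGrad, if_true, smul_zero, sub_zero, inner_zero_left, add_zero]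
    linarith
  · have hd : DifferentiableAt ℝ W x :=
      (hC1.contDiffAt (isOpen_compl_singleton.mem_nhds hx)).differentiableAt (by norm_num)
    have h1 : HasFDerivAt (fun x : Euc d => W x - lam / 2 * ‖x‖ ^ 2)
        (fderiv ℝ W x - (lam / 2) • (2 • innerSL ℝ x)) x :=
      hd.hasFDerivAt.sub ((hasStrictFDerivAt_norm_sq x).hasFDerivAt.const_mul _)
    have h2 := hconv.add_fderiv_le h1 y
    have h3 : ⟪hatGrad W x - lam • x, y - x⟫
        = (fderiv ℝ W x - (lam / 2) • (2 • innerSL ℝ x)) (y - x) := by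
      simp only [hatGrad, hx, if_false, inner_sub_left, inner_smul_left, gradient,
        InnerProductSpace.toDual_symm_apply]
      simp
      ring
    rw [h3]
    exact h2

theorem hatGrad_monotone {d : ℕ} {W : Euc d → ℝ} {lam : ℝ}
    (hsymm : ∀ x : Euc d, W (-x) = W x)
    (hconv : ConvexOn ℝ Set.univ (fun x : Euc d => W x - lam / 2 * ‖x‖ ^ 2))
    (hC1 : ContDiffOn ℝ 1 W {(0 : Euc d)}ᶜ) (x y : Euc d) :
    lam * ‖x - y‖ ^ 2 ≤ ⟪hatGrad W x - hatGrad W y, x - y⟫ := by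
  have h1 := hatGrad_subgradient hsymm hconv hC1 x y
  have h2 := hatGrad_subgradient hsymm hconv hC1 y x
  have h3 : ⟪hatGrad W x - lam • x, y - x⟫ + ⟪hatGrad W y - lam • y, x - y⟫
      = lam * ‖x - y‖ ^ 2 - ⟪hatGrad W x - hatGrad W y, x - y⟫ := by
    rw [← neg_sub x y, ← real_inner_self_eq_norm_sq]
    simp only [inner_neg_right, inner_sub_left, inner_smul_left, RCLike.conj_to_real]
    ring
  linarith

/-- A function that is measurable in space and left-continuous in time agrees, at nonnegative
times, with a jointly measurable one. -/
theorem exists_measurable_of_leftContinuous {d : ℕ} {Z : ℝ → Euc d → Euc d}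
    (hZm : ∀ t, Measurable (Z t))
    (hZc : ∀ t, 0 < t → ∀ x, Tendsto (fun s => Z s x) (𝓝[<] t) (𝓝 (Z t x))) :
    ∃ G : ℝ → Euc d → Euc d, Measurable (Function.uncurry G) ∧ ∀ t, 0 ≤ t → G t = Z t := by
  let q : ℕ → ℝ → ℝ := fun n s => ((⌈(n + 1 : ℝ) * s⌉ : ℝ) - 1) / (n + 1)
  have hq1 : ∀ (n : ℕ) s, q n s < s := fun n s => by
    simp only [q]
    rw [div_lt_iff₀ (by positivity)]
    have := Int.ceil_lt_add_one ((n + 1 : ℝ) * s)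
    linarith
  have hq2 : ∀ (n : ℕ) s, s - 1 / ((n : ℝ) + 1) ≤ q n s := fun n s => by
    simp only [q]
    rw [le_div_iff₀ (by positivity), sub_mul, div_mul_cancel₀ _ (by positivity)]
    have := Int.le_ceil ((n + 1 : ℝ) * s)
    linarith
  have hq : ∀ s, Tendsto (fun n => q n s) atTop (𝓝[<] s) := fun s => by
    refine tendsto_nhdsWithin_iff.2 ⟨?_, Eventually.of_forall fun n => hq1 n s⟩
    refine tendsto_of_tendsto_of_tendsto_of_le_of_le ?_ tendsto_const_nhds
      (fun n => hq2 n s) (fun n => (hq1 n s).le)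
    simpa using (tendsto_const_nhds (x := s)).sub (tendsto_one_div_add_atTop_nhds_zero_nat (𝕜 := ℝ))
  let G : ℝ → Euc d → Euc d := fun s x => if 0 < s then Z s x else Z 0 x
  refine ⟨G, ?_, fun t ht => ?_⟩
  swap
  · ext1 x
    rcases ht.eq_or_lt with rfl | h
    · simp [G]
    · simp [G, h]
  let F : ℕ → ℝ × Euc d → Euc d := fun n p => if 0 < p.1 then Z (q n p.1) p.2 else Z 0 p.2
  refine measurable_of_tendsto_metrizable (f := F) (fun n => ?_) (tendsto_pi_nhds.2 fun p => ?_)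
  · refine Measurable.ite (measurableSet_lt measurable_const measurable_fst) ?_
      ((hZm 0).comp measurable_snd)
    have h1 : Measurable (fun r : ℤ × Euc d => Z (((r.1 : ℝ) - 1) / (n + 1)) r.2) :=
      measurable_from_prod_countable_right fun k => hZm (((k : ℝ) - 1) / (n + 1))
    have h2 : Measurable (fun p : ℝ × Euc d => (⌈(n + 1 : ℝ) * p.1⌉, p.2)) :=
      (Int.measurable_ceil.comp (measurable_fst.const_mul _)).prodMk measurable_snd
    exact h1.comp h2
  · by_cases hp : 0 < p.1
    · simpa [F, G, Function.uncurry, hp, Function.comp_def] using (hZc p.1 hp p.2).comp (hq p.1)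
    · simp [F, G, Function.uncurry, hp]

/-- The velocity of a characteristic flow is the convolution of `hatGrad W` with the transported
measure. -/
def drift {d : ℕ} (W : Euc d → ℝ) (μ : Measure (Euc d)) (Z : ℝ → Euc d → Euc d)
    (s : ℝ) (x : Euc d) : Euc d :=
  ∫ x', hatGrad W (Z s x - Z s x') ∂μ

theorem norm_drift_le {d : ℕ} {W : Euc d → ℝ} {w : ℝ} (hw : ∀ x, ‖hatGrad W x‖ ≤ w)
    (μ : Measure (Euc d)) [IsProbabilityMeasure μ] (Z : ℝ → Euc d → Euc d) (s : ℝ) (x : Euc d) :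
    ‖drift W μ Z s x‖ ≤ w := by
  simpa [drift] using norm_integral_le_of_norm_le_const (μ := μ)
    (Eventually.of_forall fun x' => hw (Z s x - Z s x'))

theorem measurable_drift {d : ℕ} (W : Euc d → ℝ) (μ : Measure (Euc d)) [IsProbabilityMeasure μ]
    {Z : ℝ → Euc d → Euc d} (hZ : Measurable (Function.uncurry Z)) :
    Measurable (Function.uncurry (drift W μ Z)) := by
  have h : Measurable (fun p : (ℝ × Euc d) × Euc d => hatGrad W (Z p.1.1 p.1.2 - Z p.1.1 p.2)) :=
    (measurable_hatGrad W).comp ((hZ.comp measurable_fst).sub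
      (hZ.comp ((measurable_fst.comp measurable_fst).prodMk measurable_snd)))
  exact (h.stronglyMeasurable.integral_prod_right').measurable

theorem IsCharFlow.tendsto_left {d : ℕ} {W : Euc d → ℝ} {w : ℝ} (hw : ∀ x, ‖hatGrad W x‖ ≤ w)
    {μ : Measure (Euc d)} [IsProbabilityMeasure μ] {Z : ℝ → Euc d → Euc d}
    (hZ : IsCharFlow W μ Z) {t : ℝ} (ht : 0 < t) (x : Euc d) :
    Tendsto (fun s => Z s x) (𝓝[<] t) (𝓝 (Z t x)) := by
  set f : ℝ → Euc d := fun s => drift W μ Z s x with hf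
  have hZf : ∀ s, 0 ≤ s → Z s x = x - ∫ r in (0:ℝ)..s, f r := fun s hs => hZ.2 s hs x
  by_cases h : IntegrableOn f (Ioc 0 t)
  · have hc : ContinuousOn (fun s => x - ∫ r in (0:ℝ)..s, f r) (Icc 0 t) := by
      refine continuousOn_const.sub ?_
      have := intervalIntegral.continuousOn_primitive_interval (f := f) (μ := volume) (a := 0)
        (b := t) (by rwa [uIcc_of_le ht.le, integrableOn_Icc_iff_integrableOn_Ioc])
      rwa [uIcc_of_le ht.le] at this
    have h1 := (hc t (right_mem_Icc.2 ht.le)).tendsto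
    rw [← hZf t ht.le] at h1
    have h2 : 𝓝[<] t ≤ 𝓝[Icc 0 t] t := by
      rw [← nhdsWithin_Ico_eq_nhdsLT ht]
      exact nhdsWithin_mono _ Ico_subset_Icc_self
    refine (h1.mono_left h2).congr' ?_
    filter_upwards [Ico_mem_nhdsLT ht] with s hs using (hZf s hs.1).symm
  · obtain ⟨s₀, hs₀, h₀⟩ : ∃ s₀ ∈ Ico 0 t, ¬ IntegrableOn f (Ioc 0 s₀) := by
      by_contra! hcon
      refine h (integrableOn_Ioc_of_intervalIntegral_norm_bounded_right (I := w * t)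
        (b := fun n : ℕ => t - t / ((n : ℝ) + 1)) (l := atTop) (fun n => hcon _ ?_) ?_ ?_)
      · have h1 : t / ((n : ℝ) + 1) ≤ t := div_le_self ht.le (by linarith [n.cast_nonneg (α := ℝ)])
        have h2 : 0 < t / ((n : ℝ) + 1) := by positivity
        exact ⟨by linarith, by linarith⟩
      · simpa [div_eq_mul_inv] using (tendsto_const_nhds (x := t)).sub
          ((tendsto_one_div_add_atTop_nhds_zero_nat (𝕜 := ℝ)).const_mul t)
      · refine Eventually.of_forall fun n => ?_
        have h1 : t / ((n : ℝ) + 1) ≤ t := div_le_self ht.le (by linarith [n.cast_nonneg (α := ℝ)])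
        have h2 : 0 < t / ((n : ℝ) + 1) := by positivity
        have h3 : 0 ≤ w := (norm_nonneg _).trans (hw 0)
        have h4 := norm_setIntegral_le_of_norm_le_const (μ := volume) (f := fun s => ‖f s‖)
          (s := Ioc 0 (t - t / ((n : ℝ) + 1))) (C := w) (by simp)
          (fun s _ => by simpa using norm_drift_le hw μ Z s x)
        rw [Real.volume_real_Ioc_of_le (by linarith), sub_zero] at h4
        refine (le_abs_self _).trans (h4.trans ?_)
        gcongr
        linarith
    have hconst : ∀ s, s₀ ≤ s → Z s x = x := fun s hs => by
      rw [hZf s (hs₀.1.trans hs), intervalIntegral.integral_undef, sub_zero]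
      rw [intervalIntegrable_iff_integrableOn_Ioc_of_le (hs₀.1.trans hs)]
      exact fun h' => h₀ (h'.mono_set (Ioc_subset_Ioc_right hs))
    rw [hconst t hs₀.2.le]
    refine tendsto_const_nhds.congr' ?_
    filter_upwards [Ioo_mem_nhdsLT hs₀.2] with s hs using (hconst s hs.1.le).symm

theorem IsCharFlow.exists_measurable {d : ℕ} {W : Euc d → ℝ} {w : ℝ}
    (hw : ∀ x, ‖hatGrad W x‖ ≤ w) {μ : Measure (Euc d)} [IsProbabilityMeasure μ]
    {Z : ℝ → Euc d → Euc d} (hZ : IsCharFlow W μ Z) (hZm : ∀ t, Measurable (Z t)) :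
    ∃ G : ℝ → Euc d → Euc d, Measurable (Function.uncurry G) ∧ IsCharFlow W μ G ∧
      ∀ t, 0 ≤ t → G t = Z t := by
  obtain ⟨G, hG, hGZ⟩ := exists_measurable_of_leftContinuous hZm
    (fun t ht x => hZ.tendsto_left hw ht x)
  refine ⟨G, hG, ⟨fun x => by rw [hGZ 0 le_rfl, hZ.1 x], fun t ht x => ?_⟩, hGZ⟩
  rw [hGZ t ht, hZ.2 t ht x]
  congr 1
  refine intervalIntegral.integral_congr fun s hs => ?_
  rw [uIcc_of_le ht] at hs
  simp only [hGZ s hs.1]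

theorem intervalIntegrable_drift {d : ℕ} {W : Euc d → ℝ} {w : ℝ}
    (hw : ∀ x, ‖hatGrad W x‖ ≤ w) (μ : Measure (Euc d)) [IsProbabilityMeasure μ]
    {Z : ℝ → Euc d → Euc d} (hZ : Measurable (Function.uncurry Z)) (a b : ℝ) (x : Euc d) :
    IntervalIntegrable (fun s => drift W μ Z s x) volume a b := by
  refine (intervalIntegrable_const (c := w)).mono_fun ?_ ?_
  · exact ((measurable_drift W μ hZ).comp measurable_prodMk_right).aestronglyMeasurable
  · exact Eventually.of_forall fun s => (norm_drift_le hw μ Z s x).trans (le_abs_self w)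

theorem IsCharFlow.sub_eq {d : ℕ} {W : Euc d → ℝ} {w : ℝ}
    (hw : ∀ x, ‖hatGrad W x‖ ≤ w) {μ : Measure (Euc d)} [IsProbabilityMeasure μ]
    {Z : ℝ → Euc d → Euc d} (hZ : IsCharFlow W μ Z) (hZm : Measurable (Function.uncurry Z))
    {s t : ℝ} (hs : 0 ≤ s) (ht : 0 ≤ t) (x : Euc d) :
    Z t x - Z s x = -∫ r in s..t, drift W μ Z r x := by
  rw [← intervalIntegral.integral_interval_sub_left
    (intervalIntegrable_drift hw μ hZm 0 t x) (intervalIntegrable_drift hw μ hZm 0 s x),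
    hZ.2 t ht x, hZ.2 s hs x]
  simp only [drift]
  abel

/-- An odd one-sided Lipschitz kernel produces a one-sided Lipschitz interaction in `L²`. -/
theorem neg_two_mul_integral_inner_le {d : ℕ} {v : Euc d → Euc d} {w lam : ℝ}
    (hv : Measurable v) (hw : ∀ x, ‖v x‖ ≤ w) (hodd : ∀ x, v (-x) = -v x)
    (hmono : ∀ x y, lam * ‖x - y‖ ^ 2 ≤ ⟪v x - v y, x - y⟫)
    {μ μ' : Measure (Euc d)} {γ : Measure (Euc d × Euc d)} (hγ : IsCoupling γ μ μ')
    {X Y : Euc d → Euc d} (hX : Measurable X) (hY : Measurable Y)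
    (hD : MemLp (fun p : Euc d × Euc d => X p.1 - Y p.2) 2 γ) :
    -2 * ∫ p, ⟪(∫ x, v (X p.1 - X x) ∂μ) - ∫ y, v (Y p.2 - Y y) ∂μ', X p.1 - Y p.2⟫ ∂γ
      ≤ 2 * |lam| * ∫ p, ‖X p.1 - Y p.2‖ ^ 2 ∂γ := by
  obtain ⟨hprob, rfl, rfl⟩ := hγ
  set D : Euc d × Euc d → Euc d := fun p => X p.1 - Y p.2 with hDdef
  let k : (Euc d × Euc d) × (Euc d × Euc d) → Euc d :=
    fun z => v (X z.1.1 - X z.2.1) - v (Y z.1.2 - Y z.2.2)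
  have hk1 : Measurable fun z : (Euc d × Euc d) × (Euc d × Euc d) => v (X z.1.1 - X z.2.1) := by
    fun_prop
  have hk2 : Measurable fun z : (Euc d × Euc d) × (Euc d × Euc d) => v (Y z.1.2 - Y z.2.2) := by
    fun_prop
  have hkm : Measurable k := hk1.sub hk2
  have hkb : ∀ z, ‖k z‖ ≤ 2 * w := fun z => by
    refine (norm_sub_le _ _).trans ?_
    linarith [hw (X z.1.1 - X z.2.1), hw (Y z.1.2 - Y z.2.2)]
  have hDm : Measurable D := by fun_prop
  have hDint : Integrable D γ := hD.integrable (by norm_num)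
  have hD2 : Integrable (fun p => ‖D p‖ ^ 2) γ := hD.integrable_norm_pow (by norm_num)
  have hg : ∀ p : Euc d × Euc d, (∫ x, v (X p.1 - X x) ∂(γ.map Prod.fst))
      - ∫ y, v (Y p.2 - Y y) ∂(γ.map Prod.snd) = ∫ q, k (p, q) ∂γ := fun p => by
    have m1 : Measurable fun x => v (X p.1 - X x) := by fun_prop
    have m2 : Measurable fun y => v (Y p.2 - Y y) := by fun_prop
    rw [integral_map measurable_fst.aemeasurable m1.aestronglyMeasurable,
      integral_map measurable_snd.aemeasurable m2.aestronglyMeasurable, ← integral_sub]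
    · exact Integrable.of_bound (m1.comp measurable_fst).aestronglyMeasurable w
        (Eventually.of_forall fun q => hw _)
    · exact Integrable.of_bound (m2.comp measurable_snd).aestronglyMeasurable w
        (Eventually.of_forall fun q => hw _)
  have hkint : ∀ p, Integrable (fun q => k (p, q)) γ := fun p =>
    Integrable.of_bound (hkm.comp measurable_prodMk_left).aestronglyMeasurable (2 * w)
      (Eventually.of_forall fun q => hkb _)
  have hI1 : Integrable (fun z : (Euc d × Euc d) × (Euc d × Euc d) => ⟪k z, D z.1⟫)
      (γ.prod γ) := by
    refine ((hDint.norm.const_mul (2 * w)).comp_fst γ).mono'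
      (hkm.inner (hDm.comp measurable_fst)).aestronglyMeasurable (Eventually.of_forall fun z => ?_)
    exact (norm_inner_le_norm _ _).trans
      (mul_le_mul_of_nonneg_right (hkb z) (norm_nonneg _))
  have hswap : ∀ z, ⟪k z.swap, D z.swap.1⟫ = -⟪k z, D z.2⟫ := fun z => by
    have : k z.swap = -k z := by
      simp only [k, Prod.fst_swap, Prod.snd_swap]
      rw [← neg_sub (X z.1.1), ← neg_sub (Y z.1.2), hodd, hodd]
      abel
    rw [this, inner_neg_left, Prod.fst_swap]
  have hI2 : Integrable (fun z : (Euc d × Euc d) × (Euc d × Euc d) => ⟪k z, D z.2⟫)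
      (γ.prod γ) := by
    have := hI1.swap.neg
    refine this.congr (Eventually.of_forall fun z => ?_)
    change -⟪k z.swap, D z.swap.1⟫ = ⟪k z, D z.2⟫
    rw [hswap, neg_neg]
  have hLHS : ∫ p, ⟪∫ q, k (p, q) ∂γ, D p⟫ ∂γ = ∫ z, ⟪k z, D z.1⟫ ∂(γ.prod γ) := by
    rw [integral_prod _ hI1]
    refine integral_congr_ae (Eventually.of_forall fun p => ?_)
    simp only
    rw [real_inner_comm, ← integral_inner (hkint p)]
    simp only [real_inner_comm]
  have hsw : ∫ z, ⟪k z, D z.2⟫ ∂(γ.prod γ) = -∫ z, ⟪k z, D z.1⟫ ∂(γ.prod γ) := by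
    rw [← integral_prod_swap (μ := γ) (ν := γ) (fun z => ⟪k z, D z.1⟫), ← integral_neg]
    simp only [hswap, neg_neg]
  have hDD : Integrable (fun z : (Euc d × Euc d) × (Euc d × Euc d) => ⟪D z.1, D z.2⟫)
      (γ.prod γ) := by
    refine (hDint.norm.mul_prod hDint.norm).mono'
      ((hDm.comp measurable_fst).inner (hDm.comp measurable_snd)).aestronglyMeasurable
      (Eventually.of_forall fun z => norm_inner_le_norm _ _)
  have hDDnn : 0 ≤ ∫ z, ⟪D z.1, D z.2⟫ ∂(γ.prod γ) := by
    rw [integral_prod _ hDD]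
    have h1 : ∀ p, ∫ q, ⟪D p, D q⟫ ∂γ = ⟪∫ q, D q ∂γ, D p⟫ := fun p => by
      rw [integral_inner hDint, real_inner_comm]
    simp only [h1]
    rw [integral_inner hDint]
    exact real_inner_self_nonneg
  have hi1 := hD2.comp_fst γ
  have hi2 := hD2.comp_snd γ
  have hi12 : Integrable (fun z : (Euc d × Euc d) × (Euc d × Euc d) =>
    ‖D z.1‖ ^ 2 + ‖D z.2‖ ^ 2) (γ.prod γ) := hi1.add hi2
  have hpt : ∀ z, ⟪k z, D z.2⟫ - ⟪k z, D z.1⟫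
      ≤ |lam| * (‖D z.1‖ ^ 2 + ‖D z.2‖ ^ 2 - 2 * ⟪D z.1, D z.2⟫) := fun z => by
    have h1 := hmono (X z.1.1 - X z.2.1) (Y z.1.2 - Y z.2.2)
    have h2 : (X z.1.1 - X z.2.1) - (Y z.1.2 - Y z.2.2) = D z.1 - D z.2 := by
      simp only [hDdef]; abel
    rw [h2, inner_sub_right] at h1
    have h3 := norm_sub_sq_real (D z.1) (D z.2)
    have h4 : -|lam| * ‖D z.1 - D z.2‖ ^ 2 ≤ lam * ‖D z.1 - D z.2‖ ^ 2 :=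
      mul_le_mul_of_nonneg_right (neg_abs_le lam) (by positivity)
    rw [h3] at h1 h4
    change ⟪k z, D z.2⟫ - ⟪k z, D z.1⟫ ≤ _
    change _ ≤ ⟪k z, D z.1⟫ - ⟪k z, D z.2⟫ at h1
    linarith
  have hfin := integral_mono (hI2.sub hI1)
    ((hi12.sub (hDD.const_mul 2)).const_mul |lam|) hpt
  simp only [Pi.sub_apply] at hfin
  rw [integral_sub hI2 hI1, integral_const_mul, integral_sub hi12 (hDD.const_mul 2),
    integral_add hi1 hi2, integral_const_mul, integral_fun_fst (f := fun p => ‖D p‖ ^ 2),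
    integral_fun_snd (f := fun p => ‖D p‖ ^ 2)] at hfin
  simp only [probReal_univ, one_smul] at hfin
  simp only [hg]
  rw [hLHS]
  have := mul_nonneg (abs_nonneg lam) hDDnn
  linarith

/-- A quadratic expansion of the squared norm along a curve with bounded velocity `-g`. -/
theorem norm_sq_le_of_velocity {E : Type*} [NormedAddCommGroup E] [InnerProductSpace ℝ E]
    [CompleteSpace E] {D g : ℝ → E} {s t C : ℝ} (hst : s ≤ t) (hg : ∀ r, ‖g r‖ ≤ C)
    (hgi : IntervalIntegrable g volume s t)
    (hD : ∀ r ∈ Icc s t, D r - D s = -∫ q in s..r, g q)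
    (hgD : IntervalIntegrable (fun r => ⟪g r, D r⟫) volume s t) :
    ‖D t‖ ^ 2 ≤ ‖D s‖ ^ 2 - 2 * (∫ r in s..t, ⟪g r, D r⟫) + 3 * C ^ 2 * (t - s) ^ 2 := by
  have hC : 0 ≤ C := (norm_nonneg _).trans (hg s)
  have hinc : ∀ r ∈ Icc s t, ‖D r - D s‖ ≤ C * (t - s) := fun r hr => by
    rw [hD r hr, norm_neg]
    refine (intervalIntegral.norm_integral_le_of_norm_le_const fun q _ => hg q).trans ?_
    rw [abs_of_nonneg (by linarith [hr.1])]
    exact mul_le_mul_of_nonneg_left (by linarith [hr.2]) hC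
  have hexp : ‖D t‖ ^ 2 = ‖D s‖ ^ 2 + 2 * ⟪D s, D t - D s⟫ + ‖D t - D s‖ ^ 2 := by
    rw [← norm_add_sq_real, add_sub_cancel]
  have hin : ⟪D s, D t - D s⟫ = -∫ r in s..t, ⟪D s, g r⟫ := by
    rw [hD t ⟨hst, le_rfl⟩, inner_neg_right]
    congr 1
    exact ((innerSL ℝ (D s)).intervalIntegral_comp_comm hgi).symm
  have hgs : IntervalIntegrable (fun r => ⟪D s, g r⟫) volume s t :=
    ⟨(innerSL ℝ (D s)).integrable_comp hgi.1, (innerSL ℝ (D s)).integrable_comp hgi.2⟩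
  have hle : (∫ r in s..t, ⟪g r, D r⟫) ≤ ∫ r in s..t, (⟪D s, g r⟫ + C * (C * (t - s))) := by
    refine intervalIntegral.integral_mono_on hst hgD (hgs.add intervalIntegrable_const)
      fun r hr => ?_
    have h1 : ⟪g r, D r⟫ = ⟪D s, g r⟫ + ⟪g r, D r - D s⟫ := by
      rw [inner_sub_right, real_inner_comm (g r) (D s)]; ring
    rw [h1]
    gcongr
    exact (real_inner_le_norm _ _).trans (mul_le_mul (hg r) (hinc r hr) (norm_nonneg _) hC)
  rw [intervalIntegral.integral_add hgs intervalIntegrable_const,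
    intervalIntegral.integral_const, smul_eq_mul] at hle
  have hsq : ‖D t - D s‖ ^ 2 ≤ (C * (t - s)) ^ 2 :=
    pow_le_pow_left₀ (norm_nonneg _) (hinc t ⟨hst, le_rfl⟩) 2
  rw [hexp, hin]
  linarith

/-- A Grönwall inequality for functions satisfying an integral inequality on each subinterval, up
to a quadratic error. -/
theorem le_exp_mul_of_quadratic_error {u : ℝ → ℝ} {K C T : ℝ} (hT : 0 ≤ T)
    (hu : ContinuousOn u (Icc 0 T))
    (h : ∀ s t, 0 ≤ s → s ≤ t → t ≤ T →
      u t ≤ u s + K * (∫ r in s..t, u r) + C * (t - s) ^ 2) :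
    u T ≤ Real.exp (K * T) * u 0 := by
  have key := le_gronwallBound_of_liminf_deriv_right_le (f := u) (f' := fun s => K * u s)
    (δ := u 0) (K := K) (ε := 0) (a := 0) (b := T) hu ?_ le_rfl (fun x _ => by simp) T
    ⟨hT, le_rfl⟩
  · rw [gronwallBound_ε0, sub_zero] at key
    linarith
  intro s hs r hr
  refine Eventually.frequently ?_
  have hI : HasDerivWithinAt (fun t => ∫ q in s..t, u q) (u s) (Ici s) s := by
    have hmem : Icc 0 T ∈ 𝓝[>] s :=
      mem_of_superset (Icc_mem_nhdsGT hs.2) (Icc_subset_Icc_left hs.1)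
    refine intervalIntegral.integral_hasDerivWithinAt_right (t := Ioi s) (by simp) ?_ ?_
    · refine ⟨Icc 0 T, hmem, ?_⟩
      exact hu.aestronglyMeasurable measurableSet_Icc
    · exact (hu s ⟨hs.1, hs.2.le⟩).mono_of_mem_nhdsWithin hmem
  have h1 : Tendsto (fun t => K * ((t - s)⁻¹ * ∫ q in s..t, u q) + C * (t - s)) (𝓝[>] s)
      (𝓝 (K * u s + C * (s - s))) := by
    have h2 := hasDerivWithinAt_iff_tendsto_slope.1 hI
    rw [Ici_sdiff_left] at h2
    have h3 : Tendsto (fun t => (t - s)⁻¹ * ∫ q in s..t, u q) (𝓝[>] s) (𝓝 (u s)) := by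
      refine h2.congr fun t => ?_
      simp [slope, smul_eq_mul]
    refine (h3.const_mul K).add (Tendsto.const_mul C ?_)
    exact ((continuous_id.sub continuous_const).tendsto s).mono_left nhdsWithin_le_nhds
  rw [sub_self, mul_zero, add_zero] at h1
  filter_upwards [h1.eventually (gt_mem_nhds hr), Ioo_mem_nhdsGT hs.2] with t ht hst
  refine lt_of_le_of_lt ?_ ht
  have hpos : 0 < t - s := sub_pos.2 hst.1
  have h4 := h s t hs.1 hst.1.le hst.2.le
  have h5 : (t - s)⁻¹ * (u t - u s) ≤ (t - s)⁻¹ * (K * (∫ r in s..t, u r) + C * (t - s) ^ 2) :=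
    mul_le_mul_of_nonneg_left (by linarith) (by positivity)
  refine h5.trans (le_of_eq ?_)
  field_simp

theorem memLp_two_sub_of_isCoupling {d : ℕ} {μ μ' : Measure (Euc d)}
    {γ : Measure (Euc d × Euc d)} (hγ : IsCoupling γ μ μ')
    (hμ2 : Integrable (fun x : Euc d => ‖x‖ ^ 2) μ)
    (hμ'2 : Integrable (fun x : Euc d => ‖x‖ ^ 2) μ') :
    MemLp (fun p : Euc d × Euc d => p.1 - p.2) 2 γ := by
  obtain ⟨-, rfl, rfl⟩ := hγ
  have h1 : MemLp (fun p : Euc d × Euc d => p.1) 2 γ :=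
    (memLp_two_iff_integrable_sq_norm measurable_fst.aestronglyMeasurable).2
      (hμ2.comp_measurable measurable_fst)
  have h2 : MemLp (fun p : Euc d × Euc d => p.2) 2 γ :=
    (memLp_two_iff_integrable_sq_norm measurable_snd.aestronglyMeasurable).2
      (hμ'2.comp_measurable measurable_snd)
  exact h1.sub h2

/-- Stability in `L²(γ)` of jointly measurable characteristic flows. -/
theorem IsCharFlow.integral_norm_sub_sq_le {d : ℕ} {W : Euc d → ℝ} {w lam : ℝ}
    (hw : ∀ x, ‖hatGrad W x‖ ≤ w) (hodd : ∀ x, hatGrad W (-x) = -hatGrad W x)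
    (hmono : ∀ x y, lam * ‖x - y‖ ^ 2 ≤ ⟪hatGrad W x - hatGrad W y, x - y⟫)
    {μ μ' : Measure (Euc d)} [IsProbabilityMeasure μ] [IsProbabilityMeasure μ']
    {Z Z' : ℝ → Euc d → Euc d} (hZ : IsCharFlow W μ Z) (hZ' : IsCharFlow W μ' Z')
    (hZm : Measurable (Function.uncurry Z)) (hZ'm : Measurable (Function.uncurry Z'))
    {γ : Measure (Euc d × Euc d)} (hγ : IsCoupling γ μ μ')
    (hL2 : MemLp (fun p : Euc d × Euc d => p.1 - p.2) 2 γ) {T : ℝ} (hT : 0 ≤ T) :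
    ∫ p, ‖Z T p.1 - Z' T p.2‖ ^ 2 ∂γ ≤
      Real.exp (2 * |lam| * T) * ∫ p, ‖p.1 - p.2‖ ^ 2 ∂γ := by
  have hprob := hγ.1
  have hw0 : 0 ≤ w := (norm_nonneg _).trans (hw 0)
  let D : ℝ → Euc d × Euc d → Euc d := fun r p => Z r p.1 - Z' r p.2
  let g : ℝ → Euc d × Euc d → Euc d := fun r p => drift W μ Z r p.1 - drift W μ' Z' r p.2
  let B : Euc d × Euc d → ℝ := fun p => ‖p.1 - p.2‖ + 2 * w * T
  have hBL2 : MemLp B 2 γ := hL2.norm.add (memLp_const _)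
  have hdm := measurable_drift W μ hZm
  have hd'm := measurable_drift W μ' hZ'm
  have hDm : Measurable (Function.uncurry D) :=
    (hZm.comp (measurable_fst.prodMk (measurable_fst.comp measurable_snd))).sub
      (hZ'm.comp (measurable_fst.prodMk (measurable_snd.comp measurable_snd)))
  have hgm : Measurable (Function.uncurry g) :=
    (hdm.comp (measurable_fst.prodMk (measurable_fst.comp measurable_snd))).sub
      (hd'm.comp (measurable_fst.prodMk (measurable_snd.comp measurable_snd)))
  have hgb : ∀ r p, ‖g r p‖ ≤ 2 * w := fun r p => by
    refine (norm_sub_le _ _).trans ?_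
    linarith [norm_drift_le hw μ Z r p.1, norm_drift_le hw μ' Z' r p.2]
  have hgi : ∀ p a b, IntervalIntegrable (fun r => g r p) volume a b := fun p a b =>
    (intervalIntegrable_drift hw μ hZm a b p.1).sub (intervalIntegrable_drift hw μ' hZ'm a b p.2)
  have hDinc : ∀ s r, 0 ≤ s → 0 ≤ r → ∀ p, D r p - D s p = -∫ q in s..r, g q p := by
    intro s r hs hr p
    simp only [D, g]
    rw [intervalIntegral.integral_sub (intervalIntegrable_drift hw μ hZm s r p.1)
      (intervalIntegrable_drift hw μ' hZ'm s r p.2), neg_sub', ← hZ.sub_eq hw hZm hs hr,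
      ← hZ'.sub_eq hw hZ'm hs hr]
    abel
  have hDlip : ∀ s r, 0 ≤ s → 0 ≤ r → ∀ p, ‖D r p - D s p‖ ≤ 2 * w * |r - s| := by
    intro s r hs hr p
    rw [hDinc s r hs hr, norm_neg]
    exact intervalIntegral.norm_integral_le_of_norm_le_const fun q _ => hgb q p
  have hD0 : ∀ p, D 0 p = p.1 - p.2 := fun p => by simp only [D, hZ.1, hZ'.1]
  have hDB : ∀ r ∈ Icc 0 T, ∀ p, ‖D r p‖ ≤ B p := fun r hr p => by
    have h1 := hDlip 0 r le_rfl hr.1 p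
    rw [sub_zero, abs_of_nonneg hr.1, hD0] at h1
    have h2 : 2 * w * r ≤ 2 * w * T := mul_le_mul_of_nonneg_left hr.2 (by positivity)
    have h3 := norm_le_insert' (D r p) (p.1 - p.2)
    simp only [B]
    linarith
  have hDrm : ∀ r, Measurable (D r) := fun r => hDm.comp measurable_prodMk_left
  have hDL2 : ∀ r ∈ Icc 0 T, MemLp (D r) 2 γ := fun r hr =>
    hBL2.mono' (hDrm r).aestronglyMeasurable (Eventually.of_forall (hDB r hr))
  have hDc : ∀ p, ContinuousOn (fun r => D r p) (Icc 0 T) := fun p =>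
    (LipschitzOnWith.of_dist_le_mul (K := ⟨2 * w, by positivity⟩) fun r hr s hs => by
      rw [dist_eq_norm, Real.dist_eq]
      exact hDlip s r hs.1 hr.1 p).continuousOn
  have hu : ContinuousOn (fun r => ∫ p, ‖D r p‖ ^ 2 ∂γ) (Icc 0 T) := by
    refine continuousOn_of_dominated (bound := fun p => B p ^ 2)
      (fun r _ => ((hDrm r).norm.pow_const 2).aestronglyMeasurable) (fun r hr => ?_)
      hBL2.integrable_sq (Eventually.of_forall fun p => (hDc p).norm.pow 2)
    refine Eventually.of_forall fun p => ?_
    rw [norm_pow, norm_norm]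
    exact pow_le_pow_left₀ (norm_nonneg _) (hDB r hr p) 2
  have key := le_exp_mul_of_quadratic_error (K := 2 * |lam|) (C := 3 * (2 * w) ^ 2) hT hu ?_
  · simpa only [hD0] using key
  intro s t hs hst htT
  have hsub : Icc s t ⊆ Icc 0 T := Icc_subset_Icc hs htT
  have hprodint : Integrable (Function.uncurry fun p r => ⟪g r p, D r p⟫)
      (γ.prod (volume.restrict (Ioc s t))) := by
    have hBint : Integrable B γ := hBL2.integrable (by norm_num)
    refine ((hBint.const_mul (2 * w)).comp_fst (volume.restrict (Ioc s t))).mono'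
      ((hgm.comp measurable_swap).inner (hDm.comp measurable_swap)).aestronglyMeasurable ?_
    have h1 : ∀ᵐ z ∂(γ.prod (volume.restrict (Ioc s t))), z.2 ∈ Ioc s t :=
      Measure.quasiMeasurePreserving_snd.ae (ae_restrict_mem measurableSet_Ioc)
    filter_upwards [h1] with z hz
    exact (norm_inner_le_norm _ _).trans (mul_le_mul (hgb _ _)
      (hDB _ (hsub (Ioc_subset_Icc_self hz)) _) (norm_nonneg _) (by positivity))
  have hgD : ∀ p, IntervalIntegrable (fun r => ⟪g r p, D r p⟫) volume s t := fun p => by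
    rw [intervalIntegrable_iff_integrableOn_Ioc_of_le hst]
    refine Integrable.of_bound (C := 2 * w * B p) ?_ ?_
    · exact ((hgm.comp measurable_prodMk_right).inner
        (hDm.comp measurable_prodMk_right)).aestronglyMeasurable
    · filter_upwards [ae_restrict_mem measurableSet_Ioc] with r hr
      exact (norm_inner_le_norm _ _).trans (mul_le_mul (hgb _ _)
        (hDB _ (hsub (Ioc_subset_Icc_self hr)) _) (norm_nonneg _) (by positivity))
  have hpt : ∀ p, ‖D t p‖ ^ 2 ≤
      ‖D s p‖ ^ 2 - 2 * (∫ r in s..t, ⟪g r p, D r p⟫) + 3 * (2 * w) ^ 2 * (t - s) ^ 2 := fun p =>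
    norm_sq_le_of_velocity (D := fun r => D r p) (g := fun r => g r p) hst (fun r => hgb r p) (hgi p s t)
      (fun r hr => hDinc s r hs (hs.trans hr.1) p) (hgD p)
  have hsI := (hDL2 s (hsub ⟨le_rfl, hst⟩)).integrable_norm_pow (by norm_num)
  have htI := (hDL2 t (hsub ⟨hst, le_rfl⟩)).integrable_norm_pow (by norm_num)
  have hJ : Integrable (fun p => ∫ r in s..t, ⟪g r p, D r p⟫) γ := by
    simp only [intervalIntegral.integral_of_le hst]
    exact hprodint.integral_prod_left
  have hint := integral_mono htI ((hsI.sub (hJ.const_mul 2)).add (integrable_const _)) hpt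
  have hsJ : Integrable (fun p => ‖D s p‖ ^ 2 - 2 * (∫ r in s..t, ⟪g r p, D r p⟫)) γ :=
    hsI.sub (hJ.const_mul 2)
  simp only [Pi.add_apply, Pi.sub_apply] at hint
  rw [integral_add hsJ (integrable_const _), integral_sub hsI (hJ.const_mul 2),
    integral_const_mul, integral_const, probReal_univ, one_smul] at hint
  have hFub : ∫ p, (∫ r in s..t, ⟪g r p, D r p⟫) ∂γ = ∫ r in s..t, (∫ p, ⟪g r p, D r p⟫ ∂γ) := by
    simp only [intervalIntegral.integral_of_le hst]
    exact integral_integral_swap hprodint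
  have hmonoI : ∫ r in s..t, (-2 * ∫ p, ⟪g r p, D r p⟫ ∂γ) ≤
      ∫ r in s..t, (2 * |lam| * ∫ p, ‖D r p‖ ^ 2 ∂γ) := by
    refine intervalIntegral.integral_mono_on hst ?_ ?_ fun r hr => ?_
    · refine IntervalIntegrable.const_mul ?_ _
      rw [intervalIntegrable_iff_integrableOn_Ioc_of_le hst]
      exact hprodint.integral_prod_right
    · refine (ContinuousOn.intervalIntegrable ?_).const_mul _
      rw [uIcc_of_le hst]
      exact hu.mono hsub
    · exact neg_two_mul_integral_inner_le (measurable_hatGrad W) hw hodd hmono hγ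
        (hZm.comp measurable_prodMk_left) (hZ'm.comp measurable_prodMk_left) (hDL2 r (hsub hr))
  rw [intervalIntegral.integral_const_mul, intervalIntegral.integral_const_mul] at hmonoI
  rw [hFub] at hint
  linarith

/-- The pushforward of a coupling along a product map couples the pushforwards. -/
theorem IsCoupling.map {d : ℕ} {μ ν : Measure (Euc d)} {γ : Measure (Euc d × Euc d)}
    (hγ : IsCoupling γ μ ν) {X Y : Euc d → Euc d} (hX : Measurable X) (hY : Measurable Y) :
    IsCoupling (γ.map (Prod.map X Y)) (μ.map X) (ν.map Y) := by
  obtain ⟨hprob, rfl, rfl⟩ := hγ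
  refine ⟨Measure.isProbabilityMeasure_map (hX.prodMap hY).aemeasurable, ?_, ?_⟩
  · rw [Measure.map_map measurable_fst (hX.prodMap hY), Measure.map_map hX measurable_fst]
    rfl
  · rw [Measure.map_map measurable_snd (hX.prodMap hY), Measure.map_map hY measurable_snd]
    rfl

theorem wDist_map_le {d : ℕ} {μ ν : Measure (Euc d)} {X Y : Euc d → Euc d} (hX : Measurable X)
    (hY : Measurable Y) {c : ℝ} (hc : 0 ≤ c) (hne : ∃ γ, IsCoupling γ μ ν)
    (h : ∀ γ, IsCoupling γ μ ν →
      ∫ p, ‖X p.1 - Y p.2‖ ^ 2 ∂γ ≤ c ^ 2 * ∫ p, ‖p.1 - p.2‖ ^ 2 ∂γ) :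
    wDist (μ.map X) (ν.map Y) ≤ c * wDist μ ν := by
  unfold wDist
  rw [← Real.sqrt_sq hc, ← Real.sqrt_mul (sq_nonneg c)]
  refine Real.sqrt_le_sqrt ?_
  rw [← smul_eq_mul, ← Real.sInf_smul_of_nonneg (sq_nonneg c)]
  obtain ⟨γ₀, hγ₀⟩ := hne
  refine le_csInf (Set.Nonempty.smul_set ⟨_, γ₀, hγ₀, rfl⟩) ?_
  rintro _ ⟨_, ⟨γ, hγ, rfl⟩, rfl⟩
  refine le_trans (csInf_le ⟨0, ?_⟩ ⟨_, hγ.map hX hY, rfl⟩) (le_of_eq_of_le ?_ (h γ hγ))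
  · rintro _ ⟨γ', -, rfl⟩
    exact integral_nonneg fun p => sq_nonneg _
  · rw [integral_map (hX.prodMap hY).aemeasurable]
    · rfl
    · exact Measurable.aestronglyMeasurable (by fun_prop)

/-- Dobrushin-type stability estimate for characteristic flows of the aggregation
equation with a pointy potential. -/
theorem stmt2 {d : ℕ} (hd : 1 ≤ d) (W : Euc d → ℝ) (lam winf : ℝ) (hwinf : 0 ≤ winf)
    (hsymm : ∀ x : Euc d, W (-x) = W x) (hW0 : W 0 = 0)
    (hconv : ConvexOn ℝ Set.univ (fun x : Euc d => W x - lam / 2 * ‖x‖ ^ 2))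
    (hC1 : ContDiffOn ℝ 1 W {(0 : Euc d)}ᶜ)
    (hbound : ∀ x : Euc d, x ≠ 0 → ‖gradient W x‖ ≤ winf)
    (μ μ' : Measure (Euc d)) [IsProbabilityMeasure μ] [IsProbabilityMeasure μ']
    (hμ2 : Integrable (fun x : Euc d => ‖x‖ ^ 2) μ)
    (hμ'2 : Integrable (fun x : Euc d => ‖x‖ ^ 2) μ')
    (Z Z' : ℝ → Euc d → Euc d)
    (hZ : IsCharFlow W μ Z) (hZ' : IsCharFlow W μ' Z')
    (hZm : ∀ t, Measurable (Z t)) (hZ'm : ∀ t, Measurable (Z' t))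
    (γ : Measure (Euc d × Euc d)) (hγ : IsCoupling γ μ μ') :
    (∀ t : ℝ, 0 ≤ t →
      ∫ p, ‖Z t p.1 - Z' t p.2‖ ^ 2 ∂γ ≤
        Real.exp (2 * |lam| * t) * ∫ p, ‖p.1 - p.2‖ ^ 2 ∂γ) ∧
    (∀ t : ℝ, 0 ≤ t →
      wDist (μ.map (Z t)) (μ'.map (Z' t)) ≤ Real.exp (|lam| * t) * wDist μ μ') := by
  have hw := norm_hatGrad_le hwinf hbound
  obtain ⟨G, hGm, hG, hGZ⟩ := hZ.exists_measurable hw hZm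
  obtain ⟨G', hG'm, hG', hGZ'⟩ := hZ'.exists_measurable hw hZ'm
  have main : ∀ γ, IsCoupling γ μ μ' → ∀ t : ℝ, 0 ≤ t →
      ∫ p, ‖Z t p.1 - Z' t p.2‖ ^ 2 ∂γ ≤
        Real.exp (2 * |lam| * t) * ∫ p, ‖p.1 - p.2‖ ^ 2 ∂γ := fun γ hγ t ht => by
    rw [← hGZ t ht, ← hGZ' t ht]
    exact hG.integral_norm_sub_sq_le hw (hatGrad_neg hsymm) (hatGrad_monotone hsymm hconv hC1)
      hG' hGm hG'm hγ (memLp_two_sub_of_isCoupling hγ hμ2 hμ'2) ht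
  refine ⟨main γ hγ, fun t ht => ?_⟩
  refine wDist_map_le (hZm t) (hZ'm t) (Real.exp_pos _).le ⟨γ, hγ⟩ fun γ' hγ' => ?_
  rw [← Real.exp_nat_mul]
  convert main γ' hγ' t ht using 3
  push_cast
  ring
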